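/- arXiv:1410.0723 — 3 statements merged into one kernel-verified Lean document; each statement's English description precedes it below -/
import Mathlib

section
/- Let 0 < μ < L, n ≥ 1, κ = L/μ, and q = (√(1+(κ−1)/n) − 1)/(√(1+(κ−1)/n) + 1). For every γ > 0 and every deterministic IFO algorithm that performs K ≥ 0 oracle calls and outputs a point x_K ∈ ℓ2, there exists a function f ∈ F^{μ,L}_n(ℓ2) whose minimizer x*_f satisfies ‖x*_f‖ = γ and ‖x*_f − x_K‖ ≥ γ·q^{2t}, where t = 0 if K < n and t = K/n otherwise. -/
/-!
STATEMENT 0: Lower bound for deterministic IFO algorithms on the class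
`F^{μ,L}_n(ℓ2)` of finite sums `f(x) = (μ/2)‖x‖² + (1/n) ∑ᵢ gᵢ(x)` with each `gᵢ`
convex and `(L−μ)`-smooth.
-/

noncomputable section

/-- `ℓ2`, the Hilbert space of square-summable real sequences. -/
abbrev H2 : Type := lp (fun _ : ℕ => ℝ) 2

/-- A deterministic IFO algorithm making `K` oracle calls for sums of `n` components:
the `k`-th query `(i_k, x_k)` is a function of the previous `k` oracle answers
`(g_{i_j}(x_j), ∇g_{i_j}(x_j))`, and the output is a function of all `K` answers. -/
structure IFOAlgorithm (n K : ℕ) where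
  query : (k : ℕ) → (Fin k → ℝ × H2) → Fin n × H2
  output : (Fin K → ℝ × H2) → H2

namespace IFOAlgorithm

variable {n K : ℕ}

/-- The sequence of oracle answers produced when the algorithm is run against the
components `g` with gradients `gg`. -/
def answers (A : IFOAlgorithm n K) (g : Fin n → H2 → ℝ) (gg : Fin n → H2 → H2) :
    (k : ℕ) → Fin k → ℝ × H2
  | 0 => Fin.elim0
  | (k + 1) =>
    Fin.snoc (A.answers g gg k)
      ((g (A.query k (A.answers g gg k)).1 (A.query k (A.answers g gg k)).2,
        gg (A.query k (A.answers g gg k)).1 (A.query k (A.answers g gg k)).2))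

/-- The point `x_K` output by the algorithm after `K` oracle calls. -/
def run (A : IFOAlgorithm n K) (g : Fin n → H2 → ℝ) (gg : Fin n → H2 → H2) : H2 :=
  A.output (A.answers g gg K)

end IFOAlgorithm

open scoped RealInnerProductSpace

section Chain
variable {E : Type*} [NormedAddCommGroup E] [InnerProductSpace ℝ E]

/-- The coupling of consecutive vectors in the chain: `1`, except `θ` at the last link. -/
def chainWeight (θ : ℝ) (M l : ℕ) : ℝ := if l < M then 1 else θ

/-- The direction measured by the `l`-th link of the chain built on `v`. -/
def chainDir (θ : ℝ) (M : ℕ) (v : ℕ → E) (l : ℕ) : E := v l - chainWeight θ M l • v (l + 1)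

/-- The chain quadratic built on `v`, with `M + 1` links and linear term `p`. -/
def chainFun (p β θ : ℝ) (M : ℕ) (v : ℕ → E) (x : E) : ℝ :=
  β / 2 * ∑ l ∈ Finset.range (M + 1), ⟪chainDir θ M v l, x⟫ ^ 2 - p * ⟪v 0, x⟫

/-- The gradient of `chainFun`. -/
def chainGrad (p β θ : ℝ) (M : ℕ) (v : ℕ → E) (x : E) : E :=
  β • ∑ l ∈ Finset.range (M + 1), ⟪chainDir θ M v l, x⟫ • chainDir θ M v l - p • v 0

theorem chainFun_eq (p β θ : ℝ) (M : ℕ) (v : ℕ → E) (x y : E) :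
    chainFun p β θ M v y = chainFun p β θ M v x + ⟪chainGrad p β θ M v x, y - x⟫ +
      β / 2 * ∑ l ∈ Finset.range (M + 1), ⟪chainDir θ M v l, y - x⟫ ^ 2 := by
  have h : ∑ l ∈ Finset.range (M + 1), ⟪chainDir θ M v l, y⟫ ^ 2 =
      ∑ l ∈ Finset.range (M + 1), ⟪chainDir θ M v l, x⟫ ^ 2 +
      2 * ∑ l ∈ Finset.range (M + 1), ⟪chainDir θ M v l, x⟫ * ⟪chainDir θ M v l, y - x⟫ +
      ∑ l ∈ Finset.range (M + 1), ⟪chainDir θ M v l, y - x⟫ ^ 2 := by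
    rw [Finset.mul_sum, ← Finset.sum_add_distrib, ← Finset.sum_add_distrib]
    refine Finset.sum_congr rfl fun l _ => ?_
    rw [inner_sub_right]; ring
  simp only [chainFun, chainGrad, inner_sub_left, real_inner_smul_left, sum_inner, h]
  rw [inner_sub_right (v 0)]; ring

theorem chainFun_ge (p : ℝ) {β : ℝ} (hβ : 0 ≤ β) (θ : ℝ) (M : ℕ) (v : ℕ → E) (x y : E) :
    chainFun p β θ M v x + ⟪chainGrad p β θ M v x, y - x⟫ ≤ chainFun p β θ M v y := by
  rw [chainFun_eq p β θ M v x y]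
  have : 0 ≤ β / 2 * ∑ l ∈ Finset.range (M + 1), ⟪chainDir θ M v l, y - x⟫ ^ 2 := by positivity
  linarith

theorem convexOn_chainFun (p : ℝ) {β : ℝ} (hβ : 0 ≤ β) (θ : ℝ) (M : ℕ) (v : ℕ → E) :
    ConvexOn ℝ Set.univ (chainFun p β θ M v) := by
  refine ⟨convex_univ, fun x _ y _ a b ha hb hab => ?_⟩
  have hx := chainFun_ge p hβ θ M v (a • x + b • y) x
  have hy := chainFun_ge p hβ θ M v (a • x + b • y) y
  have h0 : a * ⟪chainGrad p β θ M v (a • x + b • y), x - (a • x + b • y)⟫ +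
      b * ⟪chainGrad p β θ M v (a • x + b • y), y - (a • x + b • y)⟫ = 0 := by
    rw [← real_inner_smul_right, ← real_inner_smul_right, ← inner_add_right]
    have : a • (x - (a • x + b • y)) + b • (y - (a • x + b • y)) = 0 := by
      obtain rfl : b = 1 - a := by linarith
      module
    rw [this, inner_zero_right]
  simp only [smul_eq_mul]
  have h1 := mul_le_mul_of_nonneg_left hx ha
  have h2 := mul_le_mul_of_nonneg_left hy hb
  obtain rfl : b = 1 - a := by linarith
  linarith

theorem hasGradientAt_chainFun [CompleteSpace E] (p β θ : ℝ) (M : ℕ) (v : ℕ → E) (x : E) :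
    HasGradientAt (chainFun p β θ M v) (chainGrad p β θ M v x) x := by
  rw [hasGradientAt_iff_hasFDerivAt]
  have hin : ∀ w : E, HasFDerivAt (fun y => ⟪w, y⟫) (innerSL ℝ w) x := fun w =>
    (innerSL ℝ w).hasFDerivAt
  have h := ((HasFDerivAt.fun_sum (u := Finset.range (M + 1)) fun l _ =>
    (hin (chainDir θ M v l)).pow 2).const_mul (β / 2)).sub ((hin (v 0)).const_mul p)
  refine h.congr_fderiv ?_
  ext y
  simp [chainGrad, Finset.mul_sum]
  refine Finset.sum_congr rfl fun l _ => ?_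
  ring

theorem norm_sum_smul_sq {ι : Type*} {v : ι → E} (hv : Orthonormal ℝ v) (s : Finset ι)
    (a : ι → ℝ) : ‖∑ l ∈ s, a l • v l‖ ^ 2 = ∑ l ∈ s, a l ^ 2 := by
  rw [← real_inner_self_eq_norm_sq, hv.inner_sum]
  exact Finset.sum_congr rfl fun l _ => by simp [sq]

theorem norm_sum_chainDir_sq_le {θ : ℝ} (hθ : θ ^ 2 ≤ 1) (M : ℕ) {v : ℕ → E}
    (hv : Orthonormal ℝ v) (s : Finset ℕ) (a : ℕ → ℝ) :
    ‖∑ l ∈ s, a l • chainDir θ M v l‖ ^ 2 ≤ 4 * ∑ l ∈ s, a l ^ 2 := by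
  have hsplit : ∑ l ∈ s, a l • chainDir θ M v l =
      ∑ l ∈ s, a l • v l - ∑ l ∈ s, (a l * chainWeight θ M l) • (v ∘ Nat.succ) l := by
    rw [← Finset.sum_sub_distrib]
    refine Finset.sum_congr rfl fun l _ => ?_
    simp [chainDir, smul_sub, smul_smul]
  have h1 := norm_sum_smul_sq hv s a
  have h2 := norm_sum_smul_sq (hv.comp Nat.succ Nat.succ_injective) s
    fun l => a l * chainWeight θ M l
  have h3 : ∑ l ∈ s, (a l * chainWeight θ M l) ^ 2 ≤ ∑ l ∈ s, a l ^ 2 := by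
    refine Finset.sum_le_sum fun l _ => ?_
    have : chainWeight θ M l ^ 2 ≤ 1 := by unfold chainWeight; split_ifs <;> simp [hθ]
    rw [mul_pow]
    exact mul_le_of_le_one_right (sq_nonneg _) this
  rw [hsplit]
  have h4 := norm_sub_le (∑ l ∈ s, a l • v l)
    (∑ l ∈ s, (a l * chainWeight θ M l) • (v ∘ Nat.succ) l)
  set X := ‖∑ l ∈ s, a l • v l‖
  set Y := ‖∑ l ∈ s, (a l * chainWeight θ M l) • (v ∘ Nat.succ) l‖
  have h5 := pow_le_pow_left₀ (norm_nonneg _) h4 2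
  nlinarith [sq_nonneg (X - Y)]

theorem norm_chainGrad_sub_le (p : ℝ) {β θ : ℝ} (hβ : 0 ≤ β) (hθ : θ ^ 2 ≤ 1) (M : ℕ) {v : ℕ → E}
    (hv : Orthonormal ℝ v) (x y : E) :
    ‖chainGrad p β θ M v x - chainGrad p β θ M v y‖ ≤ 4 * β * ‖x - y‖ := by
  set z := ∑ l ∈ Finset.range (M + 1), ⟪chainDir θ M v l, x - y⟫ • chainDir θ M v l with hz
  have hsub : chainGrad p β θ M v x - chainGrad p β θ M v y = β • z := by
    simp only [chainGrad, hz, inner_sub_right, sub_smul, Finset.sum_sub_distrib, smul_sub]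
    abel
  have h1 : ‖z‖ ^ 2 ≤ 4 * ⟪z, x - y⟫ := by
    refine (norm_sum_chainDir_sq_le hθ M hv _ _).trans_eq ?_
    rw [hz, sum_inner]
    congr 1
    exact Finset.sum_congr rfl fun l _ => by rw [real_inner_smul_left, sq]
  have h2 : ‖z‖ ≤ 4 * ‖x - y‖ := by
    have := real_inner_le_norm z (x - y)
    by_contra! hlt
    have hpos : 0 < ‖z‖ := lt_of_le_of_lt (by positivity) hlt
    nlinarith
  rw [hsub, norm_smul, Real.norm_of_nonneg hβ]
  nlinarith

theorem chainFun_congr (p β θ : ℝ) (M : ℕ) {v w : ℕ → E} {x : E} {c : ℕ}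
    (hvw : ∀ j ≤ c, v j = w j) (hv : ∀ j, c ≤ j → ⟪v j, x⟫ = 0) (hw : ∀ j, c ≤ j → ⟪w j, x⟫ = 0) :
    chainFun p β θ M v x = chainFun p β θ M w x ∧
      chainGrad p β θ M v x = chainGrad p β θ M w x := by
  have hlt : ∀ l, l < c → chainDir θ M v l = chainDir θ M w l := fun l hl => by
    simp only [chainDir, hvw l hl.le, hvw (l + 1) hl]
  have hgev : ∀ l, c ≤ l → ⟪chainDir θ M v l, x⟫ = 0 := fun l hl => by
    simp [chainDir, inner_sub_left, real_inner_smul_left, hv l hl, hv (l + 1) (by omega)]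
  have hgew : ∀ l, c ≤ l → ⟪chainDir θ M w l, x⟫ = 0 := fun l hl => by
    simp [chainDir, inner_sub_left, real_inner_smul_left, hw l hl, hw (l + 1) (by omega)]
  simp only [chainFun, chainGrad, hvw 0 (Nat.zero_le _)]
  constructor
  · congr 2
    refine Finset.sum_congr rfl fun l _ => ?_
    rcases lt_or_ge l c with h | h
    · rw [hlt l h]
    · rw [hgev l h, hgew l h]
  · congr 2
    refine Finset.sum_congr rfl fun l _ => ?_
    rcases lt_or_ge l c with h | h
    · rw [hlt l h]
    · rw [hgev l h, hgew l h, zero_smul, zero_smul]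

/-- The coordinates, up to scaling, of the minimizer: geometric, with the last one absorbing the tail. -/
def chainCoeff (q θ : ℝ) (M j : ℕ) : ℝ := if j < M + 1 then q ^ j else q ^ j / θ

theorem chain_stationary_interior {q lam ρ : ℝ} (h : lam * q = ρ * (1 - q)) (v : ℕ → E) (M : ℕ) :
    lam • ∑ j ∈ Finset.range (M + 1), q ^ j • v j +
      ρ • ∑ l ∈ Finset.range M, q ^ l • (v l - v (l + 1)) = (lam + ρ) • v 0 - (ρ * q ^ M) • v M := by
  induction M with
  | zero => simp [add_smul]
  | succ M ih =>
    rw [Finset.sum_range_succ, Finset.sum_range_succ (fun l => q ^ l • (v l - v (l + 1))),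
      smul_add, smul_add, add_add_add_comm, ih]
    have : lam * q ^ (M + 1) = ρ * q ^ M - ρ * q ^ (M + 1) := by
      rw [pow_succ]; linear_combination q ^ M * h
    rw [smul_smul, this]
    module

theorem chain_stationary {q lam ρ θ : ℝ} (h : lam * q = ρ * (1 - q)) (hθ : θ ≠ 0)
    (hθq : θ ^ 2 = 1 - q) (v : ℕ → E) (M : ℕ) :
    lam • ∑ j ∈ Finset.range (M + 2), chainCoeff q θ M j • v j +
      ρ • ∑ l ∈ Finset.range (M + 1), q ^ l • chainDir θ M v l = (lam + ρ) • v 0 := by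
  rw [Finset.sum_range_succ, Finset.sum_range_succ (fun l => q ^ l • chainDir θ M v l)]
  have h1 : ∑ j ∈ Finset.range (M + 1), chainCoeff q θ M j • v j =
      ∑ j ∈ Finset.range (M + 1), q ^ j • v j :=
    Finset.sum_congr rfl fun j hj => by simp [chainCoeff, Finset.mem_range.mp hj]
  have h2 : ∑ l ∈ Finset.range M, q ^ l • chainDir θ M v l =
      ∑ l ∈ Finset.range M, q ^ l • (v l - v (l + 1)) :=
    Finset.sum_congr rfl fun j hj => by simp [chainDir, chainWeight, Finset.mem_range.mp hj]
  rw [h1, h2, smul_add, smul_add, add_add_add_comm, chain_stationary_interior h]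
  have h3 : lam * (q ^ (M + 1) / θ) = ρ * q ^ M * θ := by
    field_simp
    rw [pow_succ, hθq]; linear_combination q ^ M * h
  simp only [chainCoeff, chainDir, chainWeight, lt_irrefl, if_false]
  rw [smul_smul, h3]
  module

theorem chainCoeff_sub {q θ : ℝ} (hθ : θ ≠ 0) {M l : ℕ} (hl : l < M + 1) :
    chainCoeff q θ M l - chainWeight θ M l * chainCoeff q θ M (l + 1) = (1 - q) * q ^ l := by
  rcases Nat.lt_succ_iff_lt_or_eq.mp hl with h | rfl
  · simp [chainCoeff, chainWeight, h, hl]; ring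
  · simp [chainCoeff, chainWeight]; field_simp; ring

theorem chainCoeff_tail {q θ : ℝ} (hq0 : 0 < q) (hq1 : q < 1)
    (hθq : θ ^ 2 = 1 - q) {M k : ℕ} (hk : k ≤ M + 1) :
    (q ^ k) ^ 2 * ∑ j ∈ Finset.range (M + 2), chainCoeff q θ M j ^ 2 ≤
      ∑ j ∈ Finset.Ico k (M + 2), chainCoeff q θ M j ^ 2 := by
  have hgeom : ∀ m ≤ M + 1, (1 - q ^ 2) * ∑ j ∈ Finset.range m, chainCoeff q θ M j ^ 2 =
      1 - (q ^ m) ^ 2 := fun m hm => by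
    rw [← pow_mul, mul_comm m, pow_mul, ← mul_neg_geom_sum (q ^ 2) m]
    congr 1
    refine Finset.sum_congr rfl fun j hj => ?_
    rw [chainCoeff, if_pos (by have := Finset.mem_range.mp hj; omega), pow_right_comm]
  have htot : 1 ≤ (1 - q ^ 2) * ∑ j ∈ Finset.range (M + 2), chainCoeff q θ M j ^ 2 := by
    rw [Finset.sum_range_succ, mul_add, hgeom _ le_rfl]
    have : (1 - q ^ 2) * chainCoeff q θ M (M + 1) ^ 2 = (1 + q) * (q ^ (M + 1)) ^ 2 := by
      rw [chainCoeff, if_neg (lt_irrefl _), div_pow, hθq]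
      have : 1 - q ≠ 0 := by linarith
      field_simp
      ring
    rw [this]
    nlinarith [sq_nonneg (q ^ (M + 1))]
  have hsum := Finset.sum_range_add_sum_Ico (fun j => chainCoeff q θ M j ^ 2)
    (show k ≤ M + 2 by omega)
  have hk' := hgeom k hk
  set T := ∑ j ∈ Finset.range (M + 2), chainCoeff q θ M j ^ 2
  have hqk : (q ^ k) ^ 2 ≤ 1 := pow_le_one₀ (by positivity) (pow_le_one₀ hq0.le hq1.le)
  have hpos : 0 < 1 - q ^ 2 := by nlinarith
  refine le_of_mul_le_mul_left ?_ hpos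
  nlinarith
end Chain

section Fresh
variable {E : Type*} [NormedAddCommGroup E] [InnerProductSpace ℝ E]

theorem exists_orthonormal_nat_orthogonal [CompleteSpace E] (hE : ¬ FiniteDimensional ℝ E)
    (W : Submodule ℝ E) [FiniteDimensional ℝ W] :
    ∃ u : ℕ → E, Orthonormal ℝ u ∧ ∀ m, ∀ w ∈ W, ⟪w, u m⟫ = 0 := by
  obtain ⟨w, b, -⟩ := exists_hilbertBasis ℝ Wᗮ
  have hinf : Infinite w := by
    by_contra hfin
    rw [not_infinite_iff_finite] at hfin
    have := Fintype.ofFinite w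
    have h1 : FiniteDimensional ℝ Wᗮ := b.toOrthonormalBasis.toBasis.finiteDimensional_of_finite
    have h2 : FiniteDimensional ℝ (W ⊔ Wᗮ : Submodule ℝ E) := inferInstance
    rw [Submodule.sup_orthogonal_of_hasOrthogonalProjection] at h2
    exact hE (Module.finite_def.mpr ((Submodule.fg_top ⊤).mp (Module.finite_def.mp h2)))
  refine ⟨fun m => (b (Infinite.natEmbedding w m) : E), ?_, fun m x hx => ?_⟩
  · exact (b.orthonormal.comp_linearIsometry Wᗮ.subtypeₗᵢ).comp _
      (Infinite.natEmbedding w).injective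
  · exact (b (Infinite.natEmbedding w m)).2 x hx

/-- The vectors `v (i, j)` with `c i ≤ j` can be replaced, keeping orthonormality, by vectors
orthogonal to a given finite set. -/
theorem Orthonormal.exists_refresh [CompleteSpace E] (hE : ¬ FiniteDimensional ℝ E)
    {n : ℕ} {v : Fin n × ℕ → E} (hv : Orthonormal ℝ v) (c : Fin n → ℕ) {X : Set E}
    (hX : X.Finite) :
    ∃ v' : Fin n × ℕ → E, Orthonormal ℝ v' ∧ (∀ i j, j < c i → v' (i, j) = v (i, j)) ∧
      ∀ x ∈ X, ∀ i j, c i ≤ j → ⟪v' (i, j), x⟫ = 0 := by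
  set S : Set (Fin n × ℕ) := {a | a.2 < c a.1} with hS
  have hSfin : S.Finite := by
    refine (Set.finite_univ.prod (Set.finite_lt_nat (∑ i, c i))).subset fun a ha =>
      ⟨Set.mem_univ _, ?_⟩
    exact lt_of_lt_of_le ha (Finset.single_le_sum (fun i _ => Nat.zero_le (c i))
      (Finset.mem_univ a.1))
  have : FiniteDimensional ℝ (Submodule.span ℝ (v '' S ∪ X)) :=
    FiniteDimensional.span_of_finite ℝ ((hSfin.image v).union hX)
  obtain ⟨u, hu, huW⟩ := exists_orthonormal_nat_orthogonal hE (Submodule.span ℝ (v '' S ∪ X))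
  have huv : ∀ m, ∀ a ∈ S, ⟪v a, u m⟫ = 0 := fun m a ha =>
    huW m _ (Submodule.subset_span (Or.inl ⟨a, ha, rfl⟩))
  classical
  refine ⟨fun a => if a ∈ S then v a else u (Encodable.encode a), ?_, fun i j hj => ?_,
    fun x hx i j hj => ?_⟩
  · rw [orthonormal_iff_ite] at hv hu ⊢
    intro a b
    by_cases ha : a ∈ S <;> by_cases hb : b ∈ S <;> simp only [ha, hb, if_true, if_false]
    · exact hv a b
    · rw [huv _ a ha, if_neg]
      rintro rfl; exact hb ha
    · rw [real_inner_comm, huv _ b hb, if_neg]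
      rintro rfl; exact ha hb
    · rw [hu]; simp
  · have : (i, j) ∈ S := hj
    simp [this]
  · have : (i, j) ∉ S := by simpa [hS] using hj
    simp only [this, if_false]
    rw [real_inner_comm]
    exact huW _ x (Submodule.subset_span (Or.inr hx))

end Fresh

theorem not_finiteDimensional_H2 : ¬ FiniteDimensional ℝ H2 := by
  intro h
  have b : HilbertBasis ℕ ℝ H2 := ⟨LinearIsometryEquiv.refl ℝ _⟩
  have := b.orthonormal.linearIndependent.finite
  exact not_finite ℕ

namespace IFOAlgorithm

variable {n K : ℕ}

/-- The `k`-th query made against the components `g` with gradients `gg`. -/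
def trace (A : IFOAlgorithm n K) (g : Fin n → H2 → ℝ) (gg : Fin n → H2 → H2) (k : ℕ) :
    Fin n × H2 := A.query k (A.answers g gg k)

/-- The number of times the component `i` occurs among the first `k` queries. -/
def count (A : IFOAlgorithm n K) (g : Fin n → H2 → ℝ) (gg : Fin n → H2 → H2) (k : ℕ)
    (i : Fin n) : ℕ := ((Finset.range k).filter fun m => (A.trace g gg m).1 = i).card

theorem count_mono (A : IFOAlgorithm n K) (g : Fin n → H2 → ℝ) (gg : Fin n → H2 → H2)
    (i : Fin n) : Monotone fun k => A.count g gg k i := fun _ _ h =>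
  Finset.card_le_card (Finset.filter_subset_filter _ (Finset.range_mono h))

theorem count_lt (A : IFOAlgorithm n K) (g : Fin n → H2 → ℝ) (gg : Fin n → H2 → H2) {m k : ℕ}
    (h : m < k) : A.count g gg m (A.trace g gg m).1 < A.count g gg k (A.trace g gg m).1 := by
  refine lt_of_lt_of_le ?_ (A.count_mono g gg _ (Nat.succ_le_of_lt h))
  simp [count, Finset.range_add_one, Finset.filter_insert]

theorem sum_count (A : IFOAlgorithm n K) (g : Fin n → H2 → ℝ) (gg : Fin n → H2 → H2) (k : ℕ) :
    ∑ i, A.count g gg k i = k := by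
  simpa [count] using (Finset.card_eq_sum_card_fiberwise (s := Finset.range k)
    (t := Finset.univ) (f := fun m => (A.trace g gg m).1) (by simp)).symm

theorem count_le (A : IFOAlgorithm n K) (g : Fin n → H2 → ℝ) (gg : Fin n → H2 → H2) (k : ℕ)
    (i : Fin n) : A.count g gg k i ≤ k :=
  (Finset.card_filter_le _ _).trans_eq (Finset.card_range k)

theorem answers_congr (A : IFOAlgorithm n K) {g g' : Fin n → H2 → ℝ} {gg gg' : Fin n → H2 → H2}
    {k : ℕ} (h : ∀ m < k, g (A.trace g gg m).1 (A.trace g gg m).2 =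
        g' (A.trace g gg m).1 (A.trace g gg m).2 ∧
      gg (A.trace g gg m).1 (A.trace g gg m).2 = gg' (A.trace g gg m).1 (A.trace g gg m).2) :
    ∀ m ≤ k, A.answers g gg m = A.answers g' gg' m := by
  intro m
  induction m with
  | zero => intro _; rfl
  | succ m ih =>
    intro hm
    have ihm := ih (by omega)
    obtain ⟨h1, h2⟩ := h m (by omega)
    rw [trace, ihm] at h1 h2
    rw [answers, answers, ihm, h1, h2]

theorem trace_congr (A : IFOAlgorithm n K) {g g' : Fin n → H2 → ℝ} {gg gg' : Fin n → H2 → H2}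
    {m : ℕ} (h : A.answers g gg m = A.answers g' gg' m) : A.trace g gg m = A.trace g' gg' m := by
  rw [trace, trace, h]

theorem count_congr (A : IFOAlgorithm n K) {g g' : Fin n → H2 → ℝ} {gg gg' : Fin n → H2 → H2}
    {k : ℕ} (h : ∀ m < k, A.answers g gg m = A.answers g' gg' m) (i : Fin n) :
    A.count g gg k i = A.count g' gg' k i := by
  unfold count
  congr 1
  refine Finset.filter_congr fun m hm => ?_
  rw [A.trace_congr (h m (Finset.mem_range.mp hm))]

end IFOAlgorithm

section Resisting

variable {n K : ℕ}

/-- Chain quadratics built on the rows of a doubly indexed family. -/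
def chainFuns (p β θ : ℝ) (M : ℕ) (v : Fin n × ℕ → H2) (i : Fin n) : H2 → ℝ :=
  chainFun p β θ M fun j => v (i, j)

/-- The gradients of `chainFuns`. -/
def chainGrads (p β θ : ℝ) (M : ℕ) (v : Fin n × ℕ → H2) (i : Fin n) : H2 → H2 :=
  chainGrad p β θ M fun j => v (i, j)

/-- Every vector of `v` that has not been revealed before the `m`-th query is orthogonal to the
point of that query, for the first `k` queries. -/
def Resists (A : IFOAlgorithm n K) (p β θ : ℝ) (M : ℕ) (v : Fin n × ℕ → H2) (k : ℕ) : Prop :=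
  ∀ m < k, ∀ i j, A.count (chainFuns p β θ M v) (chainGrads p β θ M v) m i ≤ j →
    ⟪v (i, j), (A.trace (chainFuns p β θ M v) (chainGrads p β θ M v) m).2⟫ = 0

theorem Resists.exists_refresh {A : IFOAlgorithm n K} {p β θ : ℝ} {M : ℕ} {v : Fin n × ℕ → H2}
    {k : ℕ} (h : Resists A p β θ M v k) (hv : Orthonormal ℝ v) (z : H2) :
    ∃ v' : Fin n × ℕ → H2, Orthonormal ℝ v' ∧ Resists A p β θ M v' k ∧
      A.answers (chainFuns p β θ M v') (chainGrads p β θ M v') k =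
        A.answers (chainFuns p β θ M v) (chainGrads p β θ M v) k ∧
      ∀ i j, A.count (chainFuns p β θ M v') (chainGrads p β θ M v') k i ≤ j →
        ⟪v' (i, j), z⟫ = 0 := by
  set g := chainFuns p β θ M v with hg
  set gg := chainGrads p β θ M v with hgg
  obtain ⟨v', hv', hagree, hperp⟩ := hv.exists_refresh not_finiteDimensional_H2 (A.count g gg k)
    (((Set.finite_lt_nat k).image fun m => (A.trace g gg m).2).insert z)
  have hperp' : ∀ m < k, ∀ i j, A.count g gg m i ≤ j → ⟪v' (i, j), (A.trace g gg m).2⟫ = 0 := by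
    intro m hm i j hj
    rcases lt_or_ge j (A.count g gg k i) with hlt | hge
    · rw [hagree i j hlt]
      exact h m hm i j hj
    · exact hperp _ (Or.inr ⟨m, hm, rfl⟩) i j hge
  have hans : ∀ m ≤ k, A.answers g gg m =
      A.answers (chainFuns p β θ M v') (chainGrads p β θ M v') m := by
    refine A.answers_congr fun m hm => ?_
    refine chainFun_congr p β θ M (c := A.count g gg m (A.trace g gg m).1) (fun j hj => ?_)
      (fun j hj => h m hm _ j hj) (fun j hj => hperp' m hm _ j hj)
    exact (hagree _ j (lt_of_le_of_lt hj (A.count_lt g gg hm))).symm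
  have hcount : ∀ m ≤ k, ∀ i, A.count g gg m i =
      A.count (chainFuns p β θ M v') (chainGrads p β θ M v') m i := fun m hm =>
    A.count_congr fun l hl => hans l (hl.le.trans hm)
  refine ⟨v', hv', fun m hm i j hj => ?_, (hans k le_rfl).symm, fun i j hj => ?_⟩
  · rw [← A.trace_congr (hans m hm.le)]
    exact hperp' m hm i j ((hcount m hm.le i).le.trans hj)
  · exact hperp z (Or.inl rfl) i j ((hcount k le_rfl i).le.trans hj)

theorem exists_resists (A : IFOAlgorithm n K) (p β θ : ℝ) (M k : ℕ) :
    ∃ v : Fin n × ℕ → H2, Orthonormal ℝ v ∧ Resists A p β θ M v k := by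
  induction k with
  | zero =>
    obtain ⟨u, hu, -⟩ := exists_orthonormal_nat_orthogonal not_finiteDimensional_H2
      (⊥ : Submodule ℝ H2)
    exact ⟨u ∘ Encodable.encode, hu.comp _ Encodable.encode_injective, fun m hm => by omega⟩
  | succ k ih =>
    obtain ⟨v, hv, h⟩ := ih
    obtain ⟨v', hv', h', hans, hz⟩ := h.exists_refresh hv
      (A.query k (A.answers (chainFuns p β θ M v) (chainGrads p β θ M v) k)).2
    refine ⟨v', hv', fun m hm i j hj => ?_⟩
    rcases Nat.lt_succ_iff_lt_or_eq.mp hm with hlt | rfl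
    · exact h' m hlt i j hj
    · rw [IFOAlgorithm.trace, hans]
      exact hz i j hj

theorem exists_resisting_run (A : IFOAlgorithm n K) (p β θ : ℝ) (M : ℕ) :
    ∃ v : Fin n × ℕ → H2, Orthonormal ℝ v ∧
      ∀ i j, A.count (chainFuns p β θ M v) (chainGrads p β θ M v) K i ≤ j →
        ⟪v (i, j), A.run (chainFuns p β θ M v) (chainGrads p β θ M v)⟫ = 0 := by
  obtain ⟨v, hv, h⟩ := exists_resists A p β θ M K
  obtain ⟨v', hv', -, hans, hz⟩ := h.exists_refresh hv
    (A.run (chainFuns p β θ M v) (chainGrads p β θ M v))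
  refine ⟨v', hv', fun i j hj => ?_⟩
  rw [IFOAlgorithm.run, hans]
  exact hz i j hj

end Resisting

theorem mul_rpow_le_sum_pow {n : ℕ} (hn : 1 ≤ n) {r : ℝ} (hr : 0 < r) (k : Fin n → ℕ) :
    (n : ℝ) * r ^ ((∑ i, k i : ℕ) / n : ℝ) ≤ ∑ i, r ^ k i := by
  have hn' : (0 : ℝ) < n := by exact_mod_cast hn
  have h := Real.geom_mean_le_arith_mean_weighted Finset.univ (fun _ : Fin n => 1 / (n : ℝ))
    (fun i => r ^ k i) (fun _ _ => by positivity) (by simp [hn'.ne']) (fun _ _ => by positivity)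
  have h2 : ∏ i, (r ^ k i) ^ (1 / (n : ℝ)) = r ^ ((∑ i, k i : ℕ) / n : ℝ) := by
    rw [Real.finsetProd_rpow _ _ fun i _ => by positivity, Finset.prod_pow_eq_pow_sum,
      ← Real.rpow_natCast, ← Real.rpow_mul hr.le, mul_one_div]
  rw [h2, ← Finset.mul_sum, one_div, inv_mul_eq_div, le_div_iff₀ hn'] at h
  linarith

theorem isMin_of_stationary {n : ℕ} {μ : ℝ} (hn : 1 ≤ n) (hμ : 0 ≤ μ) {g : Fin n → H2 → ℝ}
    {gg : Fin n → H2 → H2} {x : H2}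
    (hg : ∀ i y, g i x + ⟪gg i x, y - x⟫ ≤ g i y) (hx : (n * μ) • x + ∑ i, gg i x = 0) (y : H2) :
    μ / 2 * ‖x‖ ^ 2 + (1 / (n : ℝ)) * ∑ i, g i x ≤
      μ / 2 * ‖y‖ ^ 2 + (1 / (n : ℝ)) * ∑ i, g i y := by
  have hn' : (0 : ℝ) < n := by exact_mod_cast hn
  have h1 : ∑ i, g i x + ⟪∑ i, gg i x, y - x⟫ ≤ ∑ i, g i y := by
    rw [sum_inner, ← Finset.sum_add_distrib]
    exact Finset.sum_le_sum fun i _ => hg i y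
  have h2 : ‖y‖ ^ 2 = ‖x‖ ^ 2 + 2 * ⟪x, y - x⟫ + ‖y - x‖ ^ 2 := by
    rw [← norm_add_sq_real, add_sub_cancel]
  have h3 : n * μ * ⟪x, y - x⟫ + ⟪∑ i, gg i x, y - x⟫ = 0 := by
    rw [← real_inner_smul_left, ← inner_add_left, hx, inner_zero_left]
  have h4 : 0 ≤ μ * ‖y - x‖ ^ 2 := by positivity
  have h5 : 0 ≤ 1 / (n : ℝ) * (∑ i, g i y - ∑ i, g i x + n * μ * ⟪x, y - x⟫) :=
    mul_nonneg (by positivity) (by linarith)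
  have h6 : 1 / (n : ℝ) * (∑ i, g i y - ∑ i, g i x + n * μ * ⟪x, y - x⟫) =
      1 / (n : ℝ) * ∑ i, g i y - 1 / (n : ℝ) * ∑ i, g i x + μ * ⟪x, y - x⟫ := by
    field_simp
  rw [h2]
  linarith

theorem rate_props {μ L : ℝ} (hμ : 0 < μ) (hμL : μ < L) {n : ℕ} (hn : 1 ≤ n) {κ q : ℝ}
    (hκ : κ = L / μ)
    (hq : q = (Real.sqrt (1 + (κ - 1) / n) - 1) / (Real.sqrt (1 + (κ - 1) / n) + 1)) :
    0 < q ∧ q < 1 ∧ (n * μ) * q = (L - μ) / 4 * (1 - q) * (1 - q) := by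
  have hn' : (0 : ℝ) < n := by exact_mod_cast hn
  have hκ1 : κ - 1 = (L - μ) / μ := by rw [hκ]; field_simp
  have hpos : 0 < (κ - 1) / n := by
    rw [hκ1]; exact div_pos (div_pos (by linarith) hμ) hn'
  set s := Real.sqrt (1 + (κ - 1) / n) with hs
  have hs2 : s ^ 2 = 1 + (κ - 1) / n := Real.sq_sqrt (by linarith)
  have hs1 : 1 < s := by rw [hs]; exact Real.lt_sqrt_of_sq_lt (by linarith)
  have hs0 : s + 1 ≠ 0 := by linarith
  have h1q : 1 - q = 2 / (s + 1) := by rw [hq]; field_simp; ring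
  refine ⟨?_, ?_, ?_⟩
  · rw [hq]; exact div_pos (by linarith) (by linarith)
  · rw [hq, div_lt_one (by linarith)]; linarith
  · rw [h1q, hq]
    rw [hκ1] at hs2
    have : n * μ * (s ^ 2 - 1) = L - μ := by rw [hs2]; field_simp; ring
    rw [← this]
    field_simp
    ring

section Point
variable {E : Type*} [NormedAddCommGroup E] [InnerProductSpace ℝ E] {n : ℕ}

/-- The minimizer of the regularized sum of the chains built on `v`. -/
def chainPoint (c q θ : ℝ) (M : ℕ) (v : Fin n × ℕ → E) : E :=
  ∑ a ∈ Finset.univ ×ˢ Finset.range (M + 2), (c * chainCoeff q θ M a.2) • v a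

theorem chainPoint_eq (c q θ : ℝ) (M : ℕ) (v : Fin n × ℕ → E) :
    chainPoint c q θ M v =
      c • ∑ i, ∑ j ∈ Finset.range (M + 2), chainCoeff q θ M j • v (i, j) := by
  simp only [chainPoint, Finset.sum_product, Finset.smul_sum, smul_smul]

theorem inner_chainPoint (c q θ : ℝ) (M : ℕ) {v : Fin n × ℕ → E} (hv : Orthonormal ℝ v)
    (i : Fin n) {j : ℕ} (hj : j < M + 2) :
    ⟪v (i, j), chainPoint c q θ M v⟫ = c * chainCoeff q θ M j :=
  hv.inner_right_sum (fun a : Fin n × ℕ => c * chainCoeff q θ M a.2) (by simpa using hj)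

theorem norm_chainPoint_sq (c q θ : ℝ) (M : ℕ) {v : Fin n × ℕ → E} (hv : Orthonormal ℝ v) :
    ‖chainPoint c q θ M v‖ ^ 2 =
      c ^ 2 * (n * ∑ j ∈ Finset.range (M + 2), chainCoeff q θ M j ^ 2) := by
  rw [chainPoint, norm_sum_smul_sq hv, Finset.sum_product]
  simp [mul_pow, Finset.mul_sum, mul_left_comm]

theorem chainGrad_chainPoint {c q θ lam β p : ℝ} (hq : lam * q = β * (1 - q) * (1 - q))
    (hθ : θ ≠ 0) (hθq : θ ^ 2 = 1 - q) (hp : p = c * (lam + β * (1 - q))) (M : ℕ)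
    {v : Fin n × ℕ → E} (hv : Orthonormal ℝ v) :
    lam • chainPoint c q θ M v +
      ∑ i, chainGrad p β θ M (fun j => v (i, j)) (chainPoint c q θ M v) = 0 := by
  have hdir : ∀ i, ∀ l ∈ Finset.range (M + 1),
      ⟪chainDir θ M (fun j => v (i, j)) l, chainPoint c q θ M v⟫ = c * ((1 - q) * q ^ l) := by
    intro i l hl
    have hl' := Finset.mem_range.mp hl
    rw [← chainCoeff_sub hθ hl', chainDir, inner_sub_left, real_inner_smul_left,
      inner_chainPoint c q θ M hv i (by omega), inner_chainPoint c q θ M hv i (by omega)]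
    ring
  rw [chainPoint_eq, smul_comm, Finset.smul_sum, Finset.smul_sum, ← chainPoint_eq,
    ← Finset.sum_add_distrib]
  refine Finset.sum_eq_zero fun i _ => ?_
  have hgrad : chainGrad p β θ M (fun j => v (i, j)) (chainPoint c q θ M v) =
      c • ((β * (1 - q)) • ∑ l ∈ Finset.range (M + 1), q ^ l • chainDir θ M (fun j => v (i, j)) l)
        - p • v (i, 0) := by
    rw [chainGrad, Finset.smul_sum, Finset.smul_sum, Finset.smul_sum]
    congr 1
    refine Finset.sum_congr rfl fun l hl => ?_
    rw [hdir i l hl, smul_smul, smul_smul, smul_smul]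
    congr 1; ring
  rw [hgrad, ← add_sub_assoc, ← smul_add, chain_stationary hq hθ hθq (fun j => v (i, j)) M,
    smul_smul, hp, sub_self]

theorem le_norm_chainPoint_sub_sq (hn : 1 ≤ n) {q θ : ℝ} (hq0 : 0 < q) (hq1 : q < 1)
    (hθq : θ ^ 2 = 1 - q) (c : ℝ) (M : ℕ) {v : Fin n × ℕ → E} (hv : Orthonormal ℝ v)
    {k : Fin n → ℕ} (hk : ∀ i, k i ≤ M + 1) {z : E}
    (hz : ∀ i j, k i ≤ j → ⟪v (i, j), z⟫ = 0) :
    ‖chainPoint c q θ M v‖ ^ 2 * (q ^ ((∑ i, k i : ℕ) / n : ℝ)) ^ 2 ≤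
      ‖chainPoint c q θ M v - z‖ ^ 2 := by
  set T := ∑ j ∈ Finset.range (M + 2), chainCoeff q θ M j ^ 2 with hT
  have hbessel := hv.sum_inner_products_le (x := chainPoint c q θ M v - z)
    (s := (Finset.univ ×ˢ Finset.range (M + 2)).filter fun a => k a.1 ≤ a.2)
  refine le_trans ?_ hbessel
  have hsum : ∑ a ∈ (Finset.univ ×ˢ Finset.range (M + 2)).filter (fun a : Fin n × ℕ => k a.1 ≤ a.2),
      ‖⟪v a, chainPoint c q θ M v - z⟫‖ ^ 2 =
      ∑ i, ∑ j ∈ Finset.Ico (k i) (M + 2), c ^ 2 * chainCoeff q θ M j ^ 2 := by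
    rw [Finset.sum_filter, Finset.sum_product]
    refine Finset.sum_congr rfl fun i _ => ?_
    rw [← Finset.sum_filter]
    refine Finset.sum_congr (by ext j; simp [and_comm]) fun j hj => ?_
    obtain ⟨h1, h2⟩ := Finset.mem_Ico.mp hj
    rw [inner_sub_right, hz i j h1, sub_zero, inner_chainPoint c q θ M hv i h2, Real.norm_eq_abs,
      sq_abs, mul_pow]
  rw [hsum, norm_chainPoint_sq c q θ M hv]
  have hterm : ∀ i, c ^ 2 * T * (q ^ 2) ^ k i ≤
      ∑ j ∈ Finset.Ico (k i) (M + 2), c ^ 2 * chainCoeff q θ M j ^ 2 := fun i => by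
    rw [← Finset.mul_sum, mul_assoc, mul_comm T, pow_right_comm]
    exact mul_le_mul_of_nonneg_left (chainCoeff_tail hq0 hq1 hθq (hk i)) (sq_nonneg c)
  refine le_trans ?_ (Finset.sum_le_sum fun i _ => hterm i)
  rw [← Finset.mul_sum]
  have hT0 : 0 ≤ T := Finset.sum_nonneg fun _ _ => sq_nonneg _
  have hmean := mul_le_mul_of_nonneg_left (mul_rpow_le_sum_pow hn (pow_pos hq0 2) k)
    (mul_nonneg (sq_nonneg c) hT0)
  refine le_trans (le_of_eq ?_) hmean
  rw [← Real.rpow_natCast (q ^ _), ← Real.rpow_mul hq0.le, mul_comm _ ((2 : ℕ) : ℝ),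
    Real.rpow_mul hq0.le, Real.rpow_natCast]
  ring

end Point

theorem ifo_lower_bound_of_lt {μ L : ℝ} (hμ : 0 < μ) (hμL : μ < L) {n K : ℕ} (hK : K < n)
    {γ : ℝ} (hγ : 0 < γ) (A : IFOAlgorithm n K) :
    ∃ (g : Fin n → H2 → ℝ) (gg : Fin n → H2 → H2) (xstar : H2),
      (∀ i, ConvexOn ℝ Set.univ (g i)) ∧
      (∀ i x, HasGradientAt (g i) (gg i x) x) ∧
      (∀ i x y, ‖gg i x - gg i y‖ ≤ (L - μ) * ‖x - y‖) ∧
      (∀ y : H2,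
        μ / 2 * ‖xstar‖ ^ 2 + (1 / (n : ℝ)) * ∑ i, g i xstar ≤
          μ / 2 * ‖y‖ ^ 2 + (1 / (n : ℝ)) * ∑ i, g i y) ∧
      ‖xstar‖ = γ ∧ γ ≤ ‖xstar - A.run g gg‖ := by
  obtain ⟨i₀, hi₀⟩ : ∃ i₀, A.count (fun _ _ => 0) (fun _ _ => 0) K i₀ = 0 := by
    by_contra! h
    have h1 : ∑ _i : Fin n, 1 ≤ ∑ i, A.count (fun _ _ => 0) (fun _ _ => 0) K i :=
      Finset.sum_le_sum fun i _ => Nat.one_le_iff_ne_zero.mpr (h i)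
    rw [A.sum_count] at h1
    simp at h1
    omega
  set z := A.run (fun _ _ => 0) (fun _ _ => 0) with hz
  obtain ⟨v, hv, hvz⟩ := exists_orthonormal_nat_orthogonal not_finiteDimensional_H2
    (Submodule.span ℝ {z})
  replace hvz : ⟪z, v 0⟫ = 0 := hvz 0 z (Submodule.mem_span_singleton_self z)
  set p : Fin n → ℝ := fun i => if i = i₀ then n * μ * γ else 0 with hp
  have hrun : A.run (fun i => chainFun (p i) 0 0 0 v) (fun i => chainGrad (p i) 0 0 0 v) = z := by
    rw [hz, IFOAlgorithm.run, IFOAlgorithm.run]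
    congr 1
    refine (A.answers_congr (k := K) (fun m hm => ?_) K le_rfl).symm
    have hne : (A.trace (fun _ _ => 0) (fun _ _ => 0) m).1 ≠ i₀ := by
      rintro rfl
      exact absurd (A.count_lt _ _ hm) (by rw [hi₀]; exact Nat.not_lt_zero _)
    simp [hp, hne, chainFun, chainGrad]
  have hγv : ‖γ • v 0‖ = γ := by rw [norm_smul, hv.1 0, mul_one, Real.norm_of_nonneg hγ.le]
  refine ⟨fun i => chainFun (p i) 0 0 0 v, fun i => chainGrad (p i) 0 0 0 v, γ • v 0,
    fun i => convexOn_chainFun _ le_rfl _ _ _, fun i x => hasGradientAt_chainFun _ _ _ _ _ _,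
    fun i x y => ?_, isMin_of_stationary (by omega) hμ.le
      (fun i y => chainFun_ge _ le_rfl _ _ _ _ _) ?_, hγv, ?_⟩
  · refine (norm_chainGrad_sub_le (p i) le_rfl (by norm_num) 0 hv x y).trans ?_
    have := mul_nonneg (sub_pos.mpr hμL).le (norm_nonneg (x - y))
    linarith
  · simp [chainGrad, hp, smul_smul]
  · rw [hrun]
    have h := norm_sub_sq_real (γ • v 0) z
    rw [real_inner_smul_left, real_inner_comm, hvz, hγv] at h
    refine le_of_sq_le_sq ?_ (norm_nonneg _)
    nlinarith [sq_nonneg ‖z‖]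

theorem ifo_lower_bound_rpow {μ L : ℝ} (hμ : 0 < μ) (hμL : μ < L) {n : ℕ} (K : ℕ) (hn : 1 ≤ n)
    {q : ℝ} (hq0 : 0 < q) (hq1 : q < 1) (hq : (n * μ) * q = (L - μ) / 4 * (1 - q) * (1 - q))
    {γ : ℝ} (hγ : 0 < γ) (A : IFOAlgorithm n K) :
    ∃ (g : Fin n → H2 → ℝ) (gg : Fin n → H2 → H2) (xstar : H2),
      (∀ i, ConvexOn ℝ Set.univ (g i)) ∧
      (∀ i x, HasGradientAt (g i) (gg i x) x) ∧
      (∀ i x y, ‖gg i x - gg i y‖ ≤ (L - μ) * ‖x - y‖) ∧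
      (∀ y : H2,
        μ / 2 * ‖xstar‖ ^ 2 + (1 / (n : ℝ)) * ∑ i, g i xstar ≤
          μ / 2 * ‖y‖ ^ 2 + (1 / (n : ℝ)) * ∑ i, g i y) ∧
      ‖xstar‖ = γ ∧ γ * q ^ ((K : ℝ) / n) ≤ ‖xstar - A.run g gg‖ := by
  have hn' : (0 : ℝ) < n := by exact_mod_cast hn
  have hβ : 0 ≤ (L - μ) / 4 := by linarith
  obtain ⟨θ, hθ, hθq⟩ : ∃ θ : ℝ, θ ≠ 0 ∧ θ ^ 2 = 1 - q :=
    ⟨Real.sqrt (1 - q), (Real.sqrt_pos.mpr (by linarith)).ne', Real.sq_sqrt (by linarith)⟩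
  set T := n * ∑ j ∈ Finset.range (K + 2), chainCoeff q θ K j ^ 2 with hT
  have hT0 : 0 < T := by
    refine mul_pos hn' (lt_of_lt_of_le ?_ (Finset.single_le_sum (fun j _ => sq_nonneg _)
      (Finset.mem_range.mpr (Nat.succ_pos (K + 1)))))
    simp [chainCoeff]
  set c := γ / Real.sqrt T with hc
  have hc2 : c ^ 2 * T = γ ^ 2 := by
    rw [hc, div_pow, Real.sq_sqrt hT0.le]; field_simp
  set p := c * (n * μ + (L - μ) / 4 * (1 - q)) with hp
  obtain ⟨v, hv, hperp⟩ := exists_resisting_run A p ((L - μ) / 4) θ K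
  have hnorm : ‖chainPoint c q θ K v‖ = γ := by
    refine (pow_left_inj₀ (norm_nonneg _) hγ.le two_ne_zero).mp ?_
    rw [norm_chainPoint_sq c q θ K hv, hc2]
  refine ⟨chainFuns p ((L - μ) / 4) θ K v, chainGrads p ((L - μ) / 4) θ K v,
    chainPoint c q θ K v, fun i => convexOn_chainFun _ hβ _ _ _,
    fun i x => hasGradientAt_chainFun _ _ _ _ _ _, fun i x y => ?_,
    isMin_of_stationary hn hμ.le (fun i y => chainFun_ge _ hβ _ _ _ _ _)
      (chainGrad_chainPoint hq hθ hθq hp K hv), hnorm, ?_⟩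
  · refine (norm_chainGrad_sub_le p hβ (by linarith) K
      (hv.comp _ (Prod.mk_right_injective i)) x y).trans_eq ?_
    ring
  · have h := le_norm_chainPoint_sub_sq hn hq0 hq1 hθq c K hv
      (fun i => (A.count_le _ _ K i).trans (Nat.le_succ K)) hperp
    rw [A.sum_count, hnorm, ← mul_pow] at h
    exact le_of_sq_le_sq h (norm_nonneg _)

/-- For any deterministic IFO algorithm making `K ≥ 0` calls there is a function
`f ∈ F^{μ,L}_n(ℓ2)` (given by components `g i` with gradients `gg i`, each convex and
`(L−μ)`-smooth) whose minimizer `xstar` satisfies `‖xstar‖ = γ` and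
`‖xstar − x_K‖ ≥ γ · q^(2t)`. -/
theorem ifo_lower_bound (μ L : ℝ) (hμ : 0 < μ) (hμL : μ < L) (n K : ℕ) (hn : 1 ≤ n)
    (κ : ℝ) (hκ : κ = L / μ)
    (q : ℝ) (hq : q = (Real.sqrt (1 + (κ - 1) / n) - 1) / (Real.sqrt (1 + (κ - 1) / n) + 1))
    (t : ℝ) (ht : t = if K < n then (0 : ℝ) else (K : ℝ) / n)
    (γ : ℝ) (hγ : 0 < γ) (A : IFOAlgorithm n K) :
    ∃ (g : Fin n → H2 → ℝ) (gg : Fin n → H2 → H2) (xstar : H2),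
      (∀ i, ConvexOn ℝ Set.univ (g i)) ∧
      (∀ i x, HasGradientAt (g i) (gg i x) x) ∧
      (∀ i x y, ‖gg i x - gg i y‖ ≤ (L - μ) * ‖x - y‖) ∧
      (∀ y : H2,
        μ / 2 * ‖xstar‖ ^ 2 + (1 / (n : ℝ)) * ∑ i, g i xstar ≤
          μ / 2 * ‖y‖ ^ 2 + (1 / (n : ℝ)) * ∑ i, g i y) ∧
      ‖xstar‖ = γ ∧
      γ * q ^ (2 * t) ≤ ‖xstar - A.run g gg‖ := by
  obtain ⟨hq0, hq1, hrate⟩ := rate_props hμ hμL hn hκ hq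
  split_ifs at ht with hK
  · simpa [ht] using ifo_lower_bound_of_lt hμ hμL hK hγ A
  · obtain ⟨g, gg, xstar, h1, h2, h3, h4, h5, h6⟩ :=
      ifo_lower_bound_rpow hμ hμL K hn hq0 hq1 hrate hγ A
    refine ⟨g, gg, xstar, h1, h2, h3, h4, h5, le_trans ?_ h6⟩
    have ht0 : 0 ≤ (K : ℝ) / n := by positivity
    rw [ht]
    exact mul_le_mul_of_nonneg_left
      (Real.rpow_le_rpow_of_exponent_ge hq0 hq1.le (by linarith)) hγ.le
end
end

section
/- Let 0 < μ < L, n ≥ 1, and γ > 0. For any deterministic IFO algorithm that performs K < n oracle calls and outputs x_K, there exists a function f ∈ F^{μ,L}_n(ℓ2) whose minimizer x*_f satisfies ‖x*_f‖ = γ and ‖x*_f − x_K‖ ≥ γ. -/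
/-!
STATEMENT 5: A deterministic IFO algorithm making `K < n` oracle calls cannot achieve
any nontrivial accuracy: some `f ∈ F^{μ,L}_n(ℓ2)` with `‖x*_f‖ = γ` satisfies
`‖x*_f − x_K‖ ≥ γ`.
-/

noncomputable section

/-- An IFO algorithm receives the same answers from two families of components that agree at
every index it queries. -/
theorem IFOAlgorithm.answers_congr_s5 {n K : ℕ} (A : IFOAlgorithm n K)
    {g g' : Fin n → H2 → ℝ} {gg gg' : Fin n → H2 → H2} (m : ℕ)
    (h : ∀ k < m, g' (A.query k (A.answers g gg k)).1 = g (A.query k (A.answers g gg k)).1 ∧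
      gg' (A.query k (A.answers g gg k)).1 = gg (A.query k (A.answers g gg k)).1) :
    A.answers g' gg' m = A.answers g gg m := by
  induction m with
  | zero => rfl
  | succ m ih =>
    have hm := ih fun k hk => h k (hk.trans (Nat.lt_succ_self m))
    obtain ⟨h₁, h₂⟩ := h m (Nat.lt_succ_self m)
    simp only [IFOAlgorithm.answers, hm, h₁, h₂]

/-- With fewer than `n` queries, some component is never queried. -/
theorem IFOAlgorithm.exists_not_queried {n K : ℕ} (A : IFOAlgorithm n K) (hK : K < n)
    (g : Fin n → H2 → ℝ) (gg : Fin n → H2 → H2) :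
    ∃ i, ∀ k < K, (A.query k (A.answers g gg k)).1 ≠ i := by
  by_contra! h
  have hsurj : Function.Surjective
      fun k : Fin K => (A.query k (A.answers g gg k)).1 := fun i => by
    obtain ⟨k, hk, hki⟩ := h i
    exact ⟨⟨k, hk⟩, hki⟩
  have := Fintype.card_le_of_surjective _ hsurj
  simp only [Fintype.card_fin] at this
  omega

/-- Every point of `ℓ2` makes an inner product at most zero with some vector of given norm. -/
theorem exists_norm_eq_inner_nonpos {γ : ℝ} (hγ : 0 < γ) (z : H2) :
    ∃ v : H2, ‖v‖ = γ ∧ inner ℝ v z ≤ 0 := by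
  have hu : ‖(lp.single 2 0 γ : H2)‖ = γ := by
    rw [lp.norm_single (by norm_num), Real.norm_of_nonneg hγ.le]
  rcases le_total (inner ℝ (lp.single 2 0 γ : H2) z) 0 with h | h
  · exact ⟨_, hu, h⟩
  · exact ⟨-lp.single 2 0 γ, by rw [norm_neg, hu], by rw [inner_neg_left]; linarith⟩

/-- The vector `v` minimizes `y ↦ μ / 2 * ‖y‖ ^ 2 - μ * ⟪v, y⟫`. -/
theorem half_mul_norm_sq_sub_inner_le {E : Type*} [NormedAddCommGroup E] [InnerProductSpace ℝ E]
    {μ : ℝ} (hμ : 0 ≤ μ) (v y : E) :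
    μ / 2 * ‖v‖ ^ 2 - μ * inner ℝ v v ≤ μ / 2 * ‖y‖ ^ 2 - μ * inner ℝ v y := by
  have h := mul_nonneg hμ (sq_nonneg ‖v - y‖)
  rw [norm_sub_sq_real] at h
  rw [real_inner_self_eq_norm_sq]
  linarith

/-- If `K < n`, there is a function `f ∈ F^{μ,L}_n(ℓ2)` (given by convex
`(L−μ)`-smooth components `g i` with gradients `gg i`) whose minimizer `xstar`
satisfies `‖xstar‖ = γ` and `‖xstar − x_K‖ ≥ γ`. -/
theorem ifo_few_queries_lower_bound (μ L : ℝ) (hμ : 0 < μ) (hμL : μ < L)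
    (n K : ℕ) (hn : 1 ≤ n) (hK : K < n) (γ : ℝ) (hγ : 0 < γ) (A : IFOAlgorithm n K) :
    ∃ (g : Fin n → H2 → ℝ) (gg : Fin n → H2 → H2) (xstar : H2),
      (∀ i, ConvexOn ℝ Set.univ (g i)) ∧
      (∀ i x, HasGradientAt (g i) (gg i x) x) ∧
      (∀ i x y, ‖gg i x - gg i y‖ ≤ (L - μ) * ‖x - y‖) ∧
      (∀ y : H2,
        μ / 2 * ‖xstar‖ ^ 2 + (1 / (n : ℝ)) * ∑ i, g i xstar ≤
          μ / 2 * ‖y‖ ^ 2 + (1 / (n : ℝ)) * ∑ i, g i y) ∧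
      ‖xstar‖ = γ ∧
      γ ≤ ‖xstar - A.run g gg‖ := by
  obtain ⟨i₀, hi₀⟩ := A.exists_not_queried hK (fun _ _ => 0) (fun _ _ => 0)
  obtain ⟨v, hv, hvz⟩ :=
    exists_norm_eq_inner_nonpos hγ (A.run (fun _ _ => 0) (fun _ _ => 0))
  set w : Fin n → H2 := Pi.single i₀ (-(n * μ) • v) with hw
  have hrun : A.run (fun i x => inner ℝ (w i) x) (fun i _ => w i) =
      A.run (fun _ _ => 0) (fun _ _ => 0) := by
    unfold IFOAlgorithm.run
    rw [A.answers_congr_s5 K fun k hk => ?_]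
    have hwk : w (A.query k (A.answers (fun _ _ => 0) (fun _ _ => 0) k)).1 = 0 :=
      Pi.single_eq_of_ne (hi₀ k hk) _
    constructor <;> funext x <;> simp [hwk]
  have hn₀ : (n : ℝ) ≠ 0 := by positivity
  have hsum : ∀ y : H2, 1 / (n : ℝ) * ∑ i, inner ℝ (w i) y = -(μ * inner ℝ v y) := fun y => by
    rw [← sum_inner, hw, Fintype.sum_pi_single', inner_smul_left]
    simp only [conj_trivial]
    field_simp
  refine ⟨fun i x => inner ℝ (w i) x, fun i _ => w i, v, fun i => ?_, fun i x => ?_,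
    fun i x y => ?_, fun y => ?_, hv, ?_⟩
  · exact (innerₗ H2 (w i)).convexOn convex_univ
  · exact (innerSL ℝ (w i)).hasFDerivAt
  · rw [sub_self, norm_zero]
    exact mul_nonneg (sub_nonneg.2 hμL.le) (norm_nonneg _)
  · rw [hsum, hsum, ← sub_eq_add_neg, ← sub_eq_add_neg]
    exact half_mul_norm_sq_sub_inner_le hμ.le v y
  · rw [hrun, ← hv]
    refine le_of_sq_le_sq ?_ (norm_nonneg _)
    rw [norm_sub_sq_real]
    nlinarith [sq_nonneg ‖A.run (fun _ _ => 0) (fun _ _ => 0)‖]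
end
end

section
/- Let 0 < μ < L, ρ > 0, and define N : ℓ2 → ℝ by N(x) = ((L−μ)/8)·( x(1)² + ∑_{i=1}^∞ (x(i+1) − x(i))² − 2ρ·x(1) ) + (μ/2)‖x‖². For every k ≥ 1, if x ∈ ℓ2 satisfies x(j) = 0 for all j > k, then the gradient satisfies (∇N(x))(j) = 0 for all j > k+1; that is, x ∈ Span(e_1,…,e_k) implies ∇N(x) ∈ Span(e_1,…,e_{k+1}). -/
/-!
STATEMENT 11: The gradient of Nesterov's function increases the support by at most
one coordinate: if `x ∈ Span(e_1,…,e_k)` then `∇N(x) ∈ Span(e_1,…,e_{k+1})`.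
Coordinates are indexed by `ℕ` starting at `0`: the paper's coordinate `x(j)`
(for `j ≥ 1`) is `x (j−1)` here, so "`x(j) = 0` for all `j > k`" reads
"`x m = 0` for all `m ≥ k`", and the conclusion "`(∇N(x))(j) = 0` for all `j > k+1`"
reads "`g m = 0` for all `m ≥ k+1`".
-/

noncomputable section

/-- An even function has vanishing derivative at the origin. -/
theorem eq_zero_of_hasDerivAt_of_even {f : ℝ → ℝ} {d : ℝ} (hf : HasDerivAt f d 0)
    (heven : ∀ t, f (-t) = f t) : d = 0 := by
  have h : HasDerivAt (fun t => f (-t)) (-d) 0 := by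
    rw [← neg_zero] at hf
    simpa [Function.comp_def] using hf.comp (0 : ℝ) (hasDerivAt_neg (0 : ℝ))
  simp only [heven] at h
  linarith [hf.unique h]

theorem nesterov_gradient_span (μ L ρ : ℝ) (hμ : 0 < μ) (hμL : μ < L) (hρ : 0 < ρ)
    (N : H2 → ℝ)
    (hN : ∀ x : H2, N x =
      (L - μ) / 8 * ((x 0) ^ 2 + (∑' i : ℕ, (x (i + 1) - x i) ^ 2) - 2 * ρ * (x 0)) +
        μ / 2 * ‖x‖ ^ 2)
    (k : ℕ) (hk : 1 ≤ k) (x : H2) (hx : ∀ m : ℕ, k ≤ m → x m = 0)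
    (g : H2) (hg : HasGradientAt N g x) :
    ∀ m : ℕ, k + 1 ≤ m → g m = 0 := by
  intro m hm
  set e : H2 := lp.single 2 m (1 : ℝ) with he
  have he_ne : ∀ i, i ≠ m → e i = 0 := fun i hi => by simp [he, hi]
  have hline : HasDerivAt (fun t : ℝ => N (x + t • e)) (g m) 0 := by
    have hγ : HasDerivAt (fun t : ℝ => x + t • e) e 0 := by
      simpa using ((hasDerivAt_id (0 : ℝ)).smul_const e).const_add x
    have hg' : HasFDerivAt N (InnerProductSpace.toDual ℝ H2 g) (x + (0 : ℝ) • e) := by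
      simpa using hg.hasFDerivAt
    have hinner : inner ℝ g e = g m := by
      simp [he, lp.inner_single_right]
    simpa [Function.comp_def, hinner] using hg'.comp_hasDerivAt (0 : ℝ) hγ
  refine eq_zero_of_hasDerivAt_of_even hline fun t => ?_
  have horth : inner ℝ x e = 0 := by
    simp [he, lp.inner_single_right, hx m (by omega)]
  have hnorm : ‖x + (-t) • e‖ ^ 2 = ‖x + t • e‖ ^ 2 := by
    simp [norm_add_sq_real, inner_smul_right, horth, norm_smul]
  have hzero : (x + (-t) • e) 0 = (x + t • e) 0 := by
    simp only [lp.coeFn_add, lp.coeFn_smul, Pi.add_apply, Pi.smul_apply, he_ne 0 (by omega),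
      smul_zero]
  have hdiff : ∀ i : ℕ, ((x + (-t) • e) (i + 1) - (x + (-t) • e) i) ^ 2 =
      ((x + t • e) (i + 1) - (x + t • e) i) ^ 2 := fun i => by
    simp only [lp.coeFn_add, lp.coeFn_smul, Pi.add_apply, Pi.smul_apply, smul_eq_mul]
    by_cases h : k ≤ i
    · rw [hx i h, hx (i + 1) (by omega)]
      ring
    · rw [he_ne i (by omega), he_ne (i + 1) (by omega)]
      ring
  simp only [hN, hnorm, hzero, hdiff]
end
end
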